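/- Let G be a finite group whose order is not divisible by the characteristic of the field k, and let A be an algebra in the category Rep G of finite-dimensional k-linear representations of G (i.e., a finite-dimensional k-algebra equipped with an action of G by algebra automorphisms). If A is semisimple as a k-algebra, then the category RMod_A(Rep G) of right A-modules internal to Rep G (finite-dimensional right A-modules with a compatible G-action, g∘a = g(a)∘g) is a semisimple abelian category. -/

import Mathlib

/-!
**Statement 10** (Lemma 5.1). Let `G` be a finite group whose order is not divisible by the
characteristic of the field `k`, and let `A` be an algebra in `Rep G`, i.e. a
finite-dimensional `k`-algebra equipped with an action of `G` by (`k`-linear) algebra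
automorphisms. If `A` is a semisimple `k`-algebra, then the category `RMod_A(Rep G)` of right
`A`-modules internal to `Rep G` — finite-dimensional right `A`-modules `V` with a compatible
`G`-action (`g ∘ a = g(a) ∘ g`) — is a semisimple abelian category: every subobject (i.e.
every `G`-stable right `A`-submodule) is a direct summand by a `G`-stable right `A`-submodule.

We encode right `A`-modules as modules over `Aᵐᵒᵖ`.
-/

open MulOpposite

/-- Averaging a linear projection onto a `G`-stable submodule over `G`, when `G` acts
semilinearly over a `G`-action on the ring of right scalars, gives a `G`-equivariant linear
projection onto the same submodule. -/
theorem exists_equivariant_isProj {k G A V : Type*} [Field k] [Group G] [Fintype G]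
    (hG : (Fintype.card G : k) ≠ 0) [Ring A] [MulSemiringAction G A]
    [AddCommGroup V] [Module k V] [Module Aᵐᵒᵖ V] [SMulCommClass Aᵐᵒᵖ k V]
    [DistribMulAction G V] [SMulCommClass G k V]
    (hGA : ∀ (g : G) (a : A) (v : V), g • (op a • v) = op (g • a) • (g • v))
    (W : Submodule Aᵐᵒᵖ V) (hW : ∀ (g : G), ∀ v ∈ W, g • v ∈ W)
    (hkW : ∀ (c : k), ∀ v ∈ W, c • v ∈ W)
    {p : V →ₗ[Aᵐᵒᵖ] V} (hp : LinearMap.IsProj W p) :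
    ∃ q : V →ₗ[Aᵐᵒᵖ] V, LinearMap.IsProj W q ∧ ∀ (g : G) (v : V), q (g • v) = g • q v := by
  let q : V →ₗ[Aᵐᵒᵖ] V :=
    { toFun := fun v => (Fintype.card G : k)⁻¹ • ∑ g : G, g • p (g⁻¹ • v)
      map_add' := fun x y => by
        simp only [smul_add, map_add, Finset.sum_add_distrib]
      map_smul' := fun b v => by
        obtain ⟨a, rfl⟩ := op_surjective b
        have key : ∀ g : G, g • p (g⁻¹ • (op a • v)) = op a • (g • p (g⁻¹ • v)) := fun g => by
          rw [hGA, map_smul, hGA, smul_inv_smul]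
        simp only [key, ← Finset.smul_sum, RingHom.id_apply, smul_comm (op a)] }
  have hq : ∀ v, q v = (Fintype.card G : k)⁻¹ • ∑ g : G, g • p (g⁻¹ • v) := fun _ => rfl
  refine ⟨q, ⟨fun v => ?_, fun v hv => ?_⟩, fun h v => ?_⟩
  · exact hkW _ _ (W.sum_mem fun g _ => hW g _ (hp.map_mem _))
  · have key : ∀ g : G, g • p (g⁻¹ • v) = v := fun g => by
      rw [hp.map_id _ (hW _ _ hv), smul_inv_smul]
    rw [hq]
    simp only [key, Finset.sum_const, Finset.card_univ]
    rw [← Nat.cast_smul_eq_nsmul k, inv_smul_smul₀ hG]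
  · rw [hq, hq, smul_comm h, Finset.smul_sum (r := h)]
    congr 1
    refine (Fintype.sum_equiv (Equiv.mulLeft h) _ _ fun g => ?_).symm
    simp [mul_smul]

theorem internal_modules_over_semisimple_algebra_in_RepG_semisimple
    -- the field and the finite group, with `char k ∤ |G|`
    (k : Type u) [Field k] (G : Type u) [Group G] [Fintype G]
    (hG : (Fintype.card G : k) ≠ 0)
    -- an algebra `A` in `Rep G`: a finite-dimensional `k`-algebra with a `G`-action by
    -- `k`-algebra homomorphisms
    (A : Type u) [Ring A] [Algebra k A] [FiniteDimensional k A]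
    [MulSemiringAction G A]
    (hGk : ∀ (g : G) (c : k) (a : A), g • (c • a) = c • (g • a))
    -- `A` is semisimple as a `k`-algebra
    (hA : IsSemisimpleRing A)
    -- an object of `RMod_A(Rep G)`: a finite-dimensional right `A`-module `V` (a module over
    -- `Aᵐᵒᵖ`) with a `k`-linear `G`-action satisfying `g ∘ a = g(a) ∘ g`
    (V : Type u) [AddCommGroup V] [Module k V] [FiniteDimensional k V]
    [Module Aᵐᵒᵖ V] [IsScalarTower k Aᵐᵒᵖ V]
    [DistribMulAction G V] [SMulCommClass G k V]
    (hGA : ∀ (g : G) (a : A) (v : V), g • ((op a) • v) = (op (g • a)) • (g • v)) :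
    -- every `G`-stable right `A`-submodule `W ≤ V` admits a `G`-stable right `A`-module
    -- complement
    ∀ W : Submodule Aᵐᵒᵖ V, (∀ (g : G), ∀ v ∈ W, g • v ∈ W) →
      ∃ U : Submodule Aᵐᵒᵖ V, (∀ (g : G), ∀ v ∈ U, g • v ∈ U) ∧ IsCompl W U := by
  intro W hW
  have : SMulCommClass Aᵐᵒᵖ k V := IsScalarTower.to_smulCommClass'
  obtain ⟨U, hU⟩ := exists_isCompl W
  have hkW : ∀ (c : k), ∀ v ∈ W, c • v ∈ W := fun c v hv => W.smul_of_tower_mem c hv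
  have hp : LinearMap.IsProj W (W.projection U hU) :=
    ⟨Submodule.projection_apply_mem hU, fun _ => Submodule.projection_apply_of_mem_left hU⟩
  obtain ⟨q, hq, hqG⟩ := exists_equivariant_isProj hG hGA W hW hkW hp
  refine ⟨LinearMap.ker q, fun g v hv => ?_, hq.isCompl⟩
  rw [LinearMap.mem_ker] at hv ⊢
  rw [hqG, hv, smul_zero]
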